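/- Suppose γ* = +∞. Then the supremum of the objective value over feasible quantile functions is +∞, and there exists a sequence (c_n) in (0,1) with c_n → 1 such that each G_n(z) := k_n·1_{z ≥ c_n} on (0,1), where k_n := x / ∫_{c_n}^1 F_ρ^{-1}(1-z) dz, is a feasible quantile function and the objective values of G_n tend to +∞ as n → ∞. -/

import Mathlib

open MeasureTheory Set Filter Topology ENNReal

noncomputable section

/-- The CDF of a random variable `ρ` under the measure `μ`. -/
def cdfFun {Ω : Type*} [MeasurableSpace Ω] (μ : Measure Ω) (ρ : Ω → ℝ) : ℝ → ℝ :=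
  fun t => (μ {ω | ρ ω ≤ t}).toReal

/-- The right-continuous quantile function of `ρ`:
`F_ρ⁻¹(z) = inf {t : F_ρ(t) > z}`. -/
def rcInv {Ω : Type*} [MeasurableSpace Ω] (μ : Measure Ω) (ρ : Ω → ℝ) : ℝ → ℝ :=
  fun z => sInf {t : ℝ | z < cdfFun μ ρ t}

/-- A feasible quantile function for pricing-density `F = F_ρ⁻¹` and initial wealth `x`:
nondecreasing and right-continuous on `(0,1)`, with `lim_{z↓0} G(z) ≥ 0`, satisfying the
budget constraint `∫_0^1 F(1-z) G(z) dz ≤ x`. -/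
def Feasible (F : ℝ → ℝ) (x : ℝ) (G : ℝ → ℝ) : Prop :=
  MonotoneOn G (Set.Ioo 0 1)
  ∧ (∀ z ∈ Set.Ioo (0:ℝ) 1, Filter.Tendsto G (nhdsWithin z (Set.Ioi z)) (nhds (G z)))
  ∧ (∃ L, 0 ≤ L ∧ Filter.Tendsto G (nhdsWithin 0 (Set.Ioi 0)) (nhds L))
  ∧ ∫⁻ z in Set.Ioo (0:ℝ) 1, ENNReal.ofReal (F (1 - z) * G z) ≤ ENNReal.ofReal x

/-- The extension `Ḡ` of a (nonnegative) quantile function `G` from `(0,1)` to `[0,1]`,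
valued in `[0,∞]`, with `Ḡ(0) = lim_{z↓0} G(z)` and `Ḡ(1) = lim_{z↑1} G(z)`
(these limits are the inf/sup over `(0,1)` since `G` is nondecreasing). -/
def Gbar (G : ℝ → ℝ) : ℝ → ℝ≥0∞ := fun z =>
  if z = 0 then ⨅ y ∈ Set.Ioo (0:ℝ) 1, ENNReal.ofReal (G y)
  else if z = 1 then ⨆ y ∈ Set.Ioo (0:ℝ) 1, ENNReal.ofReal (G y)
  else ENNReal.ofReal (G z)

/-- The objective value `∫_{[0,1]} Ḡ(z) m(dz)` of a quantile function `G`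
(for `m` a Borel probability measure carried by `[0,1]`). -/
def objVal (m : Measure ℝ) (G : ℝ → ℝ) : ℝ≥0∞ := ∫⁻ z, Gbar G z ∂m

/-- `ζ(c) = m([c,1]) / ∫_c^1 F(1-z) dz`. -/
def zeta (F : ℝ → ℝ) (m : Measure ℝ) (c : ℝ) : ℝ :=
  (m (Set.Icc c 1)).toReal / ∫ z in c..1, F (1 - z)

lemma cdfFun_eq_zero_of_nonpos {Ω : Type*} [MeasurableSpace Ω] (μ : Measure Ω) {ρ : Ω → ℝ}
    (hρ : ∀ ω, 0 < ρ ω) {t : ℝ} (ht : t ≤ 0) : cdfFun μ ρ t = 0 := by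
  have : {ω | ρ ω ≤ t} = ∅ := by
    ext ω
    simpa using ht.trans_lt (hρ ω)
  simp [cdfFun, this]

lemma exists_lt_cdfFun {Ω : Type*} [MeasurableSpace Ω] (μ : Measure Ω) [IsProbabilityMeasure μ]
    (ρ : Ω → ℝ) {z : ℝ} (hz : z < 1) : ∃ t, z < cdfFun μ ρ t := by
  have hmono : Monotone fun t : ℝ => {ω | ρ ω ≤ t} := fun a b hab ω hω => le_trans hω hab
  have huniv : ⋃ t : ℝ, {ω | ρ ω ≤ t} = univ := by
    ext ω
    simpa using ⟨ρ ω, le_rfl⟩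
  have h := tendsto_measure_iUnion_atTop (μ := μ) hmono
  rw [huniv, measure_univ] at h
  have h' := (ENNReal.tendsto_toReal ENNReal.one_ne_top).comp h
  exact ((tendsto_order.1 h').1 z (by simpa using hz)).exists

lemma rcInv_pos {Ω : Type*} [MeasurableSpace Ω] (μ : Measure Ω) [IsProbabilityMeasure μ]
    {ρ : Ω → ℝ} (hρ : ∀ ω, 0 < ρ ω) (hcdf : Continuous (cdfFun μ ρ)) {z : ℝ}
    (hz : z ∈ Ioo (0 : ℝ) 1) : 0 < rcInv μ ρ z := by
  have h0 : ∀ᶠ t in 𝓝 (0 : ℝ), cdfFun μ ρ t < z :=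
    hcdf.continuousAt.eventually_lt continuousAt_const
      (by simpa [cdfFun_eq_zero_of_nonpos μ hρ le_rfl] using hz.1)
  obtain ⟨ε, hε, hball⟩ := Metric.eventually_nhds_iff.1 h0
  refine (half_pos hε).trans_le (le_csInf (exists_lt_cdfFun μ ρ hz.2) fun t ht => ?_)
  by_contra! hlt
  have ht' : z < cdfFun μ ρ t := ht
  rcases le_or_gt t 0 with h | h
  · rw [cdfFun_eq_zero_of_nonpos μ hρ h] at ht'
    exact ht'.not_gt hz.1
  · refine ht'.not_gt (hball ?_)
    rw [Real.dist_eq, sub_zero, abs_of_pos h]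
    linarith

lemma feasible_step {F : ℝ → ℝ} {x c : ℝ} (hx : 0 ≤ x) (hc : c ∈ Ioo (0 : ℝ) 1)
    (hF : ∀ z ∈ Ioo (0 : ℝ) 1, 0 < F z)
    (hint : IntervalIntegrable (fun z => F (1 - z)) volume c 1)
    (hpos : 0 < ∫ t in c..1, F (1 - t)) :
    Feasible F x (fun z => if c ≤ z then x / ∫ t in c..1, F (1 - t) else 0) := by
  set k := x / ∫ t in c..1, F (1 - t) with hk
  have hk0 : 0 ≤ k := div_nonneg hx hpos.le
  refine ⟨fun a _ b _ hab => ?_, fun z _ => ?_, ⟨0, le_rfl, ?_⟩, ?_⟩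
  · dsimp only
    split_ifs with h1 h2 h2
    · exact le_rfl
    · exact absurd (h1.trans hab) h2
    · exact hk0
    · exact le_rfl
  · rcases lt_or_ge z c with h | h
    · refine tendsto_const_nhds.congr' ?_
      filter_upwards [mem_nhdsWithin_of_mem_nhds (Iio_mem_nhds h)] with y hy
      rw [if_neg (not_le.2 h), if_neg (not_le.2 hy)]
    · refine tendsto_const_nhds.congr' ?_
      filter_upwards [self_mem_nhdsWithin] with y hy
      rw [if_pos h, if_pos (h.trans (le_of_lt hy))]
  · refine tendsto_const_nhds.congr' ?_
    filter_upwards [mem_nhdsWithin_of_mem_nhds (Iio_mem_nhds hc.1)] with y hy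
    rw [if_neg (not_le.2 hy)]
  · have hle : ∀ z, ENNReal.ofReal (F (1 - z) * if c ≤ z then k else 0)
        = (Ici c).indicator (fun z => ENNReal.ofReal (F (1 - z) * k)) z := fun z => by
      by_cases h : c ≤ z <;> simp [h]
    have hinter : Ici c ∩ Ioo 0 1 = Ico c 1 := by
      ext z
      simp only [mem_inter_iff, mem_Ici, mem_Ioo, mem_Ico]
      exact ⟨fun h => ⟨h.1, h.2.2⟩, fun h => ⟨h.1, hc.1.trans_le h.1, h.2⟩⟩
    simp_rw [hle]
    rw [lintegral_indicator measurableSet_Ici, Measure.restrict_restrict measurableSet_Ici, hinter,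
      setLIntegral_congr Ioo_ae_eq_Ico.symm, ← ofReal_integral_eq_lintegral_ofReal]
    · rw [integral_mul_const, ← integral_Ioc_eq_integral_Ioo,
        ← intervalIntegral.integral_of_le hc.2.le, hk, mul_div_cancel₀ _ hpos.ne']
    · exact (((intervalIntegrable_iff_integrableOn_Ioo_of_le hc.2.le).1 hint).mul_const k)
    · filter_upwards [ae_restrict_mem measurableSet_Ioo] with z hz
      exact mul_nonneg (hF _ ⟨by linarith [hz.2], by linarith [hz.1, hc.1]⟩).le hk0

lemma le_objVal_step (m : Measure ℝ) {c k : ℝ} (hc : c ∈ Ioo (0 : ℝ) 1) :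
    ENNReal.ofReal k * m (Icc c 1) ≤ objVal m (fun z => if c ≤ z then k else 0) := by
  rw [← setLIntegral_const]
  refine (setLIntegral_mono_ae' measurableSet_Icc (ae_of_all _ fun z hz => ?_)).trans
    (setLIntegral_le_lintegral _ _)
  have hz0 : z ≠ 0 := (hc.1.trans_le hz.1).ne'
  rw [Gbar, if_neg hz0]
  by_cases h1 : z = 1
  · rw [if_pos h1]
    exact le_iSup₂_of_le c hc (by simp)
  · simp [h1, hz.1]

lemma intervalIntegral_pos_tail {F : ℝ → ℝ} {c : ℝ} (hc : c ∈ Ioo (0 : ℝ) 1)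
    (hF : ∀ z ∈ Ioo (0 : ℝ) 1, 0 < F z)
    (hint : IntervalIntegrable (fun z => F (1 - z)) volume c 1) :
    0 < ∫ t in c..1, F (1 - t) :=
  intervalIntegral.intervalIntegral_pos_of_pos_on hint
    (fun z hz => hF _ ⟨by linarith [hz.2], by linarith [hz.1, hc.1]⟩) hc.2

/-- If `ζ` is unbounded on `(0,1)`, then it takes arbitrarily large values arbitrarily close
to `1`. -/
lemma exists_zeta_gt_near_one {F : ℝ → ℝ} {m : Measure ℝ} [IsProbabilityMeasure m]
    (hF : ∀ z ∈ Ioo (0 : ℝ) 1, 0 < F z)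
    (hint : IntervalIntegrable (fun z => F (1 - z)) volume 0 1)
    (hγ : (⨆ c ∈ Ioo (0 : ℝ) 1, ENNReal.ofReal (zeta F m c)) = ⊤)
    {c₀ : ℝ} (hc₀ : c₀ ∈ Ioo (0 : ℝ) 1) (M : ℝ) :
    ∃ c ∈ Ioo c₀ 1, M < zeta F m c := by
  have hsub : ∀ a ∈ Ioo (0 : ℝ) 1, ∀ b ∈ Icc (0 : ℝ) 1,
      IntervalIntegrable (fun z => F (1 - z)) volume a b := fun a ha b hb =>
    hint.mono_set (by
      rw [uIcc_of_le zero_le_one]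
      exact uIcc_subset_Icc ⟨ha.1.le, ha.2.le⟩ hb)
  have hI₀ := intervalIntegral_pos_tail hc₀ hF (hsub c₀ hc₀ 1 (by simp))
  set B := max M (1 / ∫ t in c₀..1, F (1 - t)) with hB
  have hlt : ENNReal.ofReal B < ⨆ c ∈ Ioo (0 : ℝ) 1, ENNReal.ofReal (zeta F m c) := by
    rw [hγ]
    exact ENNReal.ofReal_lt_top
  obtain ⟨c, hc⟩ := lt_iSup_iff.1 hlt
  obtain ⟨hc01, hcB⟩ := lt_iSup_iff.1 hc
  have hζ : B < zeta F m c := (ENNReal.ofReal_lt_ofReal_iff'.1 hcB).1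
  refine ⟨c, ⟨?_, hc01.2⟩, (le_max_left _ _).trans_lt hζ⟩
  by_contra! hle
  refine ((le_max_right M _).trans_lt hζ).not_ge ?_
  have hI : ∫ t in c₀..1, F (1 - t) ≤ ∫ t in c..1, F (1 - t) := by
    rw [← intervalIntegral.integral_add_adjacent_intervals
      (hsub c hc01 c₀ ⟨hc₀.1.le, hc₀.2.le⟩) (hsub c₀ hc₀ 1 (by simp))]
    have : 0 ≤ ∫ t in c..c₀, F (1 - t) := intervalIntegral.integral_nonneg hle fun z hz =>
      (hF _ ⟨by linarith [hz.2, hc₀.2], by linarith [hz.1, hc01.1]⟩).le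
    linarith
  exact div_le_div₀ zero_le_one measureReal_le_one hI₀ hI

/-- if `γ* = +∞`, the supremum of the objective value over feasible
quantile functions is `+∞`, and there is a sequence `(c_n) ⊆ (0,1)` with `c_n → 1` such
that each `G_n(z) = k_n·1_{z ≥ c_n}` with `k_n = x / ∫_{c_n}^1 F_ρ⁻¹(1-z) dz` is feasible
and the objective values of `G_n` tend to `+∞`. -/
theorem ill_posed_of_gammaStar_top
    {Ω : Type*} [MeasurableSpace Ω] (μ : Measure Ω) [IsProbabilityMeasure μ]
    (ρ : Ω → ℝ) (hρmeas : Measurable ρ) (hρpos : ∀ ω, 0 < ρ ω)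
    (hρint : Integrable ρ μ) (hcdf : Continuous (cdfFun μ ρ))
    (m : Measure ℝ) [IsProbabilityMeasure m] (hm : m (Set.Icc (0:ℝ) 1)ᶜ = 0)
    (x δ : ℝ) (hx : 0 < x) (hδpos : 0 < δ)
    (hδ1 : δ = ∫ ω, ρ ω ∂μ) (hδ2 : δ = ∫ z in (0:ℝ)..1, rcInv μ ρ (1 - z))
    (hγ : (⨆ c ∈ Set.Ioo (0:ℝ) 1, ENNReal.ofReal (zeta (rcInv μ ρ) m c)) = ⊤) :
    (⨆ (G : ℝ → ℝ) (_ : Feasible (rcInv μ ρ) x G), objVal m G) = ⊤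
    ∧ ∃ c : ℕ → ℝ, (∀ n, c n ∈ Set.Ioo (0:ℝ) 1)
        ∧ Filter.Tendsto c Filter.atTop (nhds 1)
        ∧ (∀ n : ℕ, Feasible (rcInv μ ρ) x
            (fun z => if c n ≤ z then x / ∫ t in (c n)..1, rcInv μ ρ (1 - t) else 0))
        ∧ Filter.Tendsto
            (fun n => objVal m
              (fun z => if c n ≤ z then x / ∫ t in (c n)..1, rcInv μ ρ (1 - t) else 0))
            Filter.atTop (nhds ⊤) := by
  have hF : ∀ z ∈ Ioo (0 : ℝ) 1, 0 < rcInv μ ρ z := fun z hz => rcInv_pos μ hρpos hcdf hz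
  have hint : IntervalIntegrable (fun z => rcInv μ ρ (1 - z)) volume 0 1 := by
    by_contra h
    exact hδpos.ne' (hδ2.trans (intervalIntegral.integral_undef h))
  have hstart : ∀ n : ℕ, 1 - 1 / ((n : ℝ) + 2) ∈ Ioo (0 : ℝ) 1 := fun n => by
    have h2 : (0 : ℝ) < n + 2 := by positivity
    have h1 : 1 / ((n : ℝ) + 2) < 1 := by
      rw [div_lt_one h2]
      linarith [(Nat.cast_nonneg n : (0 : ℝ) ≤ n)]
    exact ⟨by linarith, by linarith [one_div_pos.2 h2]⟩
  choose c hc hζ using fun n : ℕ => exists_zeta_gt_near_one hF hint hγ (hstart n) n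
  have hc01 : ∀ n, c n ∈ Ioo (0 : ℝ) 1 := fun n => ⟨(hstart n).1.trans (hc n).1, (hc n).2⟩
  have hintc : ∀ n, IntervalIntegrable (fun z => rcInv μ ρ (1 - z)) volume (c n) 1 := fun n =>
    hint.mono_set (by
      rw [uIcc_of_le zero_le_one]
      exact uIcc_subset_Icc ⟨(hc01 n).1.le, (hc01 n).2.le⟩ (by simp))
  have hI := fun n => intervalIntegral_pos_tail (hc01 n) hF (hintc n)
  have hfeas := fun n => feasible_step hx.le (hc01 n) hF (hintc n) (hI n)
  have hctend : Tendsto c atTop (𝓝 1) := by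
    refine tendsto_of_tendsto_of_tendsto_of_le_of_le ?_ tendsto_const_nhds
      (fun n => (hc n).1.le) (fun n => (hc n).2.le)
    have h := (tendsto_const_nhds (x := (1 : ℝ))).div_atTop
      (tendsto_atTop_add_const_right atTop (2 : ℝ) tendsto_natCast_atTop_atTop)
    simpa using tendsto_const_nhds (x := (1 : ℝ)) |>.sub h
  have hobj : Tendsto (fun n => objVal m
      (fun z => if c n ≤ z then x / ∫ t in (c n)..1, rcInv μ ρ (1 - t) else 0))
      atTop (𝓝 ⊤) := by
    have hlow : Tendsto (fun n : ℕ => ENNReal.ofReal (x * n)) atTop (𝓝 ⊤) :=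
      ENNReal.tendsto_ofReal_atTop.comp (tendsto_natCast_atTop_atTop.const_mul_atTop hx)
    refine tendsto_nhds_top_mono' hlow fun n => le_trans ?_ (le_objVal_step m (hc01 n))
    rw [← ENNReal.ofReal_toReal (measure_ne_top m (Icc (c n) 1)),
      ← ENNReal.ofReal_mul (div_nonneg hx.le (hI n).le)]
    refine ENNReal.ofReal_le_ofReal ?_
    rw [div_mul_eq_mul_div, mul_div_assoc]
    exact mul_le_mul_of_nonneg_left (hζ n).le hx.le
  exact ⟨top_unique (le_of_tendsto' hobj fun n => le_iSup₂_of_le _ (hfeas n) le_rfl),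
    c, hc01, hctend, hfeas, hobj⟩
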